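/- arXiv:2403.20094 — 2 statements merged into one kernel-verified Lean document; each statement's English description precedes it below -/
import Mathlib

section
/- Suppose there is exactly one Rabi resonance n₁ (so n₁ ≥ 1, ξn₁+η is the square of an integer, and no other integer n ≥ 1 has this property), and let β > 0. Define μ⁽¹⁾(k) = exp(−kβε)/Z₁ for 0 ≤ k ≤ n₁−1 and μ⁽¹⁾(k) = 0 otherwise, where Z₁ = ∑_{i=0}^{n₁−1} exp(−iβε); and μ⁽²⁾(k) = exp(−kβε)/Z₂ for k ≥ n₁ and μ⁽²⁾(k) = 0 otherwise, where Z₂ = ∑_{i≥n₁} exp(−iβε). Then μ⁽¹⁾ and μ⁽²⁾ are invariant probability distributions for the birth–death kernel p, and every probability distribution ν on ℕ satisfying ∑_{k∈ℕ} ν(k)·p(k,ℓ) = ν(ℓ) for all ℓ is a convex combination of μ⁽¹⁾ and μ⁽²⁾. (Fock-diagonal version of Theorem 5.1, part 1.) -/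
open MeasureTheory Filter Real
open scoped ENNReal

noncomputable def pMinus (β ε : ℝ) : ℝ := 1 / (1 + Real.exp (-(β * ε)))

noncomputable def pPlus (β ε : ℝ) : ℝ := Real.exp (-(β * ε)) / (1 + Real.exp (-(β * ε)))

noncomputable def rabiAlpha (ξ η : ℝ) (k : ℕ) : ℝ :=
  if k = 0 then 0
  else Real.sin (Real.pi * Real.sqrt (ξ * k + η)) ^ 2 * (ξ * k) / (ξ * k + η)

def IsRabiResonance (ξ η : ℝ) (n : ℕ) : Prop :=
  1 ≤ n ∧ ∃ j : ℕ, ξ * n + η = (j : ℝ) ^ 2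

def NonResonant (ξ η : ℝ) : Prop := ∀ n : ℕ, ¬ IsRabiResonance ξ η n

noncomputable def bdKernel (β ε ξ η : ℝ) (k l : ℕ) : ℝ :=
  if l = k + 1 then pPlus β ε * rabiAlpha ξ η (k + 1)
  else if l + 1 = k then pMinus β ε * rabiAlpha ξ η k
  else if l = k then 1 - pMinus β ε * rabiAlpha ξ η k - pPlus β ε * rabiAlpha ξ η (k + 1)
  else 0

noncomputable def muGibbs (β ε : ℝ) (k : ℕ) : ℝ :=
  (1 - Real.exp (-(β * ε))) * Real.exp (-(k : ℝ) * (β * ε))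

noncomputable def bdKernelPow (β ε ξ η : ℝ) : ℕ → ℕ → ℕ → ℝ
  | 0, k, l => if k = l then 1 else 0
  | t + 1, k, l => ∑' j : ℕ, bdKernelPow β ε ξ η t k j * bdKernel β ε ξ η j l

inductive Outcome : Type
  | mm | mp | pm | pp
  deriving DecidableEq

instance : MeasurableSpace Outcome := ⊤

noncomputable def stepWeight (β ε ξ η : ℝ) (k : ℕ) : Outcome → ℝ
  | .mm => pMinus β ε * (1 - rabiAlpha ξ η k)
  | .mp => pMinus β ε * rabiAlpha ξ η k
  | .pm => pPlus β ε * rabiAlpha ξ η (k + 1)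
  | .pp => pPlus β ε * (1 - rabiAlpha ξ η (k + 1))

def stepSucc (k : ℕ) : Outcome → ℕ
  | .mm => k
  | .mp => k - 1
  | .pm => k + 1
  | .pp => k

noncomputable def wordWeight (β ε ξ η : ℝ) : ℕ → List Outcome → ℝ
  | _, [] => 1
  | k, a :: w => stepWeight β ε ξ η k a * wordWeight β ε ξ η (stepSucc k a) w

def cylinder (w : List Outcome) : Set (ℕ → Outcome) :=
  {ω | ∀ i : Fin w.length, ω i = w.get i}

def outDelta : Outcome → ℤ
  | .mp => -1
  | .pm => 1
  | _ => 0

def sShift (ω : ℕ → Outcome) (t : ℕ) : ℤ := ∑ u ∈ Finset.range t, outDelta (ω u)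

noncomputable def tauExt (k : ℕ) (ω : ℕ → Outcome) : ℕ∞ :=
  sInf ((fun t : ℕ => (t : ℕ∞)) '' {t : ℕ | 1 ≤ t ∧ (k : ℤ) + sShift ω t < 0})

noncomputable def NFock (k : ℕ) (ω : ℕ → Outcome) (t : ℕ) : ℤ :=
  if (t : ℕ∞) < tauExt k ω then (k : ℤ) + sShift ω t else -1

noncomputable def firstReturn (k : ℕ) (ω : ℕ → Outcome) : ℕ∞ :=
  sInf ((fun t : ℕ => (t : ℕ∞)) '' {t : ℕ | 1 ≤ t ∧ NFock k ω t = (k : ℤ)})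

/-- The local Gibbs distribution on the first Rabi sector `{0,…,n₁−1}`. -/
noncomputable def muOne (β ε : ℝ) (n₁ : ℕ) (k : ℕ) : ℝ :=
  if k < n₁ then
    Real.exp (-(k : ℝ) * (β * ε)) / ∑ i ∈ Finset.range n₁, Real.exp (-(i : ℝ) * (β * ε))
  else 0

/-- The local Gibbs distribution on the second Rabi sector `{n₁, n₁+1, …}`. -/
noncomputable def muTwo (β ε : ℝ) (n₁ : ℕ) (k : ℕ) : ℝ :=
  if n₁ ≤ k then
    Real.exp (-(k : ℝ) * (β * ε)) /
      ∑' i : ℕ, Real.exp (-(((n₁ + i : ℕ) : ℝ)) * (β * ε))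
  else 0


theorem aux_tsum (β ε ξ η : ℝ) (ν : ℕ → ℝ) :
    (∑' k : ℕ, ν k * bdKernel β ε ξ η k 0 =
      ν 0 + rabiAlpha ξ η 1 * (pMinus β ε * ν 1 - pPlus β ε * ν 0)) ∧
    ∀ m, (∑' k : ℕ, ν k * bdKernel β ε ξ η k (m+1) = ν (m+1)
      + rabiAlpha ξ η (m+2) * (pMinus β ε * ν (m+2) - pPlus β ε * ν (m+1))
      - rabiAlpha ξ η (m+1) * (pMinus β ε * ν (m+1) - pPlus β ε * ν m)) := by
  constructor
  · rw [tsum_eq_sum (s := Finset.range 2)]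
    · have h0 : rabiAlpha ξ η 0 = 0 := by simp [rabiAlpha]
      simp [Finset.sum_range_succ, bdKernel, h0]
      ring
    · intro k hk
      simp only [Finset.mem_range] at hk
      unfold bdKernel
      rw [if_neg (by omega), if_neg (by omega), if_neg (by omega), mul_zero]
  · intro m
    rw [tsum_eq_sum (s := {m, m+1, m+2})]
    · rw [Finset.sum_insert (by simp), Finset.sum_insert (by simp), Finset.sum_singleton]
      have e1 : bdKernel β ε ξ η m (m+1) = pPlus β ε * rabiAlpha ξ η (m + 1) := by
        simp [bdKernel]
      have e2 : bdKernel β ε ξ η (m+1) (m+1) = 1 - pMinus β ε * rabiAlpha ξ η (m+1)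
          - pPlus β ε * rabiAlpha ξ η (m + 2) := by
        simp [bdKernel]
      have e3 : bdKernel β ε ξ η (m+2) (m+1) = pMinus β ε * rabiAlpha ξ η (m + 2) := by
        simp [bdKernel]
      rw [e1, e2, e3]
      ring
    · intro k hk
      simp only [Finset.mem_insert, Finset.mem_singleton] at hk
      unfold bdKernel
      rw [if_neg (by omega), if_neg (by omega), if_neg (by omega), mul_zero]

theorem aux_inv (β ε ξ η : ℝ) (ν : ℕ → ℝ) :
    (∀ l : ℕ, (∑' k : ℕ, ν k * bdKernel β ε ξ η k l) = ν l) ↔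
    ∀ m, rabiAlpha ξ η (m+1) * (ν (m+1) - Real.exp (-(β * ε)) * ν m) = 0 := by
  have hq := Real.exp_pos (-(β * ε))
  have key : ∀ m, rabiAlpha ξ η (m+1) * (pMinus β ε * ν (m+1) - pPlus β ε * ν m)
      = (rabiAlpha ξ η (m+1) * (ν (m+1) - Real.exp (-(β * ε)) * ν m))
        / (1 + Real.exp (-(β * ε))) := by
    intro m
    unfold pMinus pPlus
    field_simp
  have key2 : ∀ m, rabiAlpha ξ η (m+1) * (pMinus β ε * ν (m+1) - pPlus β ε * ν m) = 0 ↔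
      rabiAlpha ξ η (m+1) * (ν (m+1) - Real.exp (-(β * ε)) * ν m) = 0 := by
    intro m
    rw [key, div_eq_zero_iff]
    constructor
    · rintro (h | h)
      · exact h
      · linarith
    · exact Or.inl
  simp_rw [← key2]
  obtain ⟨h0, h1⟩ := aux_tsum β ε ξ η ν
  constructor
  · intro h m
    induction m with
    | zero => have := h 0; rw [h0] at this; simp only [zero_add]; linarith
    | succ m ih => have := h (m+1); rw [h1] at this; rw [show m+1+1 = m+2 from rfl]; linarith
  · intro h l
    cases l with
    | zero => rw [h0]; have := h 0; simp only [zero_add] at this; linarith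
    | succ m => rw [h1]; have a := h m; have b := h (m+1); rw [show m+1+1 = m+2 from rfl] at b; linarith

theorem aux_alpha (ξ η : ℝ) (hξ : 0 < ξ) (hη : 0 ≤ η) (m : ℕ) :
    rabiAlpha ξ η (m+1) = 0 ↔ IsRabiResonance ξ η (m+1) := by
  have hpos : 0 < ξ * ((m+1 : ℕ) : ℝ) := by positivity
  have hx : 0 < ξ * ((m+1 : ℕ) : ℝ) + η := by linarith
  unfold rabiAlpha IsRabiResonance
  rw [if_neg (by omega), div_eq_zero_iff, mul_eq_zero]
  constructor
  · rintro ((h | h) | h)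
    · refine ⟨by omega, ?_⟩
      have h' := pow_eq_zero_iff (two_ne_zero) |>.1 h
      rw [Real.sin_eq_zero_iff] at h'
      obtain ⟨n, hn⟩ := h'
      have hn' : (n : ℝ) = Real.sqrt (ξ * ((m+1 : ℕ) : ℝ) + η) := by
        have := Real.pi_pos
        apply mul_left_cancel₀ this.ne'
        linarith
      refine ⟨n.natAbs, ?_⟩
      rw [Nat.cast_natAbs, Int.cast_abs, sq_abs, hn', Real.sq_sqrt hx.le]
    · linarith
    · linarith
  · rintro ⟨-, j, hj⟩
    left; left
    rw [hj, Real.sqrt_sq (by positivity), mul_comm, Real.sin_nat_mul_pi]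
    simp

theorem aux_exp (β ε : ℝ) (k : ℕ) :
    Real.exp (-(k : ℝ) * (β * ε)) = Real.exp (-(β * ε)) ^ k := by
  rw [← Real.exp_nat_mul]; ring_nf

/-- Fock-diagonal version of Theorem 5.1, part 1: with exactly one Rabi
resonance `n₁` and `β > 0`, the local Gibbs distributions `μ⁽¹⁾, μ⁽²⁾` are invariant
probability distributions for the birth–death kernel, and every invariant probability
distribution is a convex combination of them. -/
theorem statement16 (ε β ξ η : ℝ) (hε : 0 < ε) (hβ : 0 < β) (hξ : 0 < ξ) (hη : 0 ≤ η)
    (n₁ : ℕ) (hres : IsRabiResonance ξ η n₁)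
    (huniq : ∀ n : ℕ, IsRabiResonance ξ η n → n = n₁) :
    ((∑' k : ℕ, muOne β ε n₁ k) = 1 ∧
      ∀ l : ℕ, (∑' k : ℕ, muOne β ε n₁ k * bdKernel β ε ξ η k l) = muOne β ε n₁ l) ∧
    ((∑' k : ℕ, muTwo β ε n₁ k) = 1 ∧
      ∀ l : ℕ, (∑' k : ℕ, muTwo β ε n₁ k * bdKernel β ε ξ η k l) = muTwo β ε n₁ l) ∧
    (∀ ν : ℕ → ℝ, (∀ k, 0 ≤ ν k) → (∑' k : ℕ, ν k) = 1 →
      (∀ l : ℕ, (∑' k : ℕ, ν k * bdKernel β ε ξ η k l) = ν l) →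
      ∃ c : ℝ, 0 ≤ c ∧ c ≤ 1 ∧
        ∀ k : ℕ, ν k = c * muOne β ε n₁ k + (1 - c) * muTwo β ε n₁ k) := by
  have hq0 := Real.exp_pos (-(β * ε))
  have hq1 : Real.exp (-(β * ε)) < 1 := by
    rw [Real.exp_lt_one_iff]
    have := mul_pos hβ hε
    linarith
  have hn1 : 1 ≤ n₁ := hres.1
  have halpha : ∀ m, m + 1 ≠ n₁ → rabiAlpha ξ η (m+1) ≠ 0 := by
    intro m hm h
    exact hm (huniq _ ((aux_alpha ξ η hξ hη m).1 h))
  have halpha1 : ∀ m, m + 1 = n₁ → rabiAlpha ξ η (m+1) = 0 := by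
    intro m hm
    exact (aux_alpha ξ η hξ hη m).2 (hm ▸ hres)
  simp_rw [aux_inv]
  unfold muOne muTwo
  simp_rw [aux_exp]
  generalize Real.exp (-(β * ε)) = q at *
  have hZ2 : HasSum (fun i : ℕ => q ^ (n₁ + i)) (q ^ n₁ * (1 - q)⁻¹) := by
    simp_rw [pow_add]
    exact (hasSum_geometric_of_lt_one hq0.le hq1).mul_left _
  rw [hZ2.tsum_eq]
  have hZ1 : 0 < ∑ i ∈ Finset.range n₁, q ^ i :=
    Finset.sum_pos (fun i _ => pow_pos hq0 i) ⟨0, by simp; omega⟩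
  generalize hZ1d : ∑ i ∈ Finset.range n₁, q ^ i = Z₁ at *
  have hZ2p : 0 < q ^ n₁ * (1 - q)⁻¹ := by
    have : 0 < 1 - q := by linarith
    positivity
  generalize hZ2d : q ^ n₁ * (1 - q)⁻¹ = Z₂ at *
  refine ⟨⟨?_, ?_⟩, ⟨?_, ?_⟩, ?_⟩
  · rw [tsum_eq_sum (s := Finset.range n₁)]
    · rw [Finset.sum_congr rfl (g := fun i => q ^ i / Z₁)]
      · rw [← Finset.sum_div, hZ1d, div_self hZ1.ne']
      · intro k hk
        rw [if_pos (Finset.mem_range.1 hk)]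
    · intro k hk
      rw [if_neg (by simpa using hk)]
  · intro m
    by_cases hm : m + 1 = n₁
    · rw [halpha1 m hm, zero_mul]
    · apply mul_eq_zero_of_right
      by_cases h : m + 1 < n₁
      · rw [if_pos h, if_pos (by omega)]; ring
      · rw [if_neg h, if_neg (by omega)]; ring
  · have hs : HasSum (fun i : ℕ => if n₁ ≤ i + n₁ then q ^ (i + n₁) / Z₂ else 0) 1 := by
      have := hZ2.div_const Z₂
      rw [div_self hZ2p.ne'] at this
      have he : (fun i : ℕ => if n₁ ≤ i + n₁ then q ^ (i + n₁) / Z₂ else 0)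
          = fun i => q ^ (n₁ + i) / Z₂ := by
        funext i
        rw [if_pos (by omega), add_comm]
      rw [he]
      exact this
    have h2 := (hasSum_nat_add_iff (f := fun k => if n₁ ≤ k then q ^ k / Z₂ else 0) n₁).1 hs
    rw [h2.tsum_eq, Finset.sum_eq_zero, add_zero]
    intro k hk
    rw [if_neg (by have := Finset.mem_range.1 hk; omega)]
  · intro m
    by_cases hm : m + 1 = n₁
    · rw [halpha1 m hm, zero_mul]
    · apply mul_eq_zero_of_right
      by_cases h : m + 1 < n₁
      · rw [if_neg (by omega), if_neg (by omega)]; ring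
      · rw [if_pos (by omega), if_pos (by omega)]; ring
  · intro ν hν hsum hinv
    have hrec : ∀ m, m + 1 ≠ n₁ → ν (m+1) = q * ν m := by
      intro m hm
      have := (mul_eq_zero.1 (hinv m)).resolve_left (halpha m hm)
      linarith
    have hlow : ∀ k, k < n₁ → ν k = q ^ k * ν 0 := by
      intro k
      induction k with
      | zero => intro _; simp
      | succ k ih =>
        intro hk
        rw [hrec k (by omega), ih (by omega)]; ring
    have hhigh : ∀ i, ν (i + n₁) = q ^ (n₁ + i) * (ν n₁ / q ^ n₁) := by
      have hqn : q ^ n₁ ≠ 0 := (pow_pos hq0 _).ne'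
      intro i
      induction i with
      | zero => rw [zero_add, add_zero]; field_simp
      | succ i ih =>
        rw [show i + 1 + n₁ = (i + n₁) + 1 by ring, hrec _ (by omega), ih]; ring
    have hsl : ∑ k ∈ Finset.range n₁, ν k = Z₁ * ν 0 := by
      rw [← hZ1d, Finset.sum_mul]
      exact Finset.sum_congr rfl fun k hk => hlow k (Finset.mem_range.1 hk)
    have hsh : HasSum (fun i => ν (i + n₁)) (Z₂ * (ν n₁ / q ^ n₁)) := by
      simp_rw [hhigh]
      exact hZ2.mul_right _
    have htot := ((hasSum_nat_add_iff n₁).1 hsh).tsum_eq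
    rw [hsum, hsl] at htot
    have hp2 : 0 ≤ Z₂ * (ν n₁ / q ^ n₁) :=
      mul_nonneg hZ2p.le (div_nonneg (hν _) (pow_pos hq0 _).le)
    refine ⟨Z₁ * ν 0, mul_nonneg hZ1.le (hν 0), by linarith, ?_⟩
    intro k
    have h1c : 1 - Z₁ * ν 0 = Z₂ * (ν n₁ / q ^ n₁) := by linarith
    rw [h1c]
    by_cases hk : k < n₁
    · rw [if_pos hk, if_neg (by omega), hlow k hk]
      field_simp
      try ring
    · rw [if_neg hk, if_pos (by omega)]
      obtain ⟨i, rfl⟩ : ∃ i, k = i + n₁ := ⟨k - n₁, by omega⟩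
      rw [hhigh, add_comm i n₁, mul_zero, zero_add]
      generalize ν n₁ / q ^ n₁ = w
      field_simp
end

section
/- Suppose there are infinitely many Rabi resonances, listed increasingly as n₁ < n₂ < ⋯, set n₀ = 0 and let I_j = {n_{j−1}, n_{j−1}+1, …, n_j − 1} for j ≥ 1 (each I_j is finite). Assume the system is non-degenerate, i.e., at most one sector I_j has exactly one element, and let β ∈ ℝ. Define μ⁽ʲ⁾(k) = exp(−kβε)/(∑_{i∈I_j} exp(−iβε)) for k ∈ I_j and μ⁽ʲ⁾(k) = 0 otherwise. Then each μ⁽ʲ⁾ is an invariant probability distribution for the birth–death kernel p, and for every probability distribution ν on ℕ and every k ∈ ℕ, lim_{t→∞} ∑_{i∈ℕ} ν(i)·p^t(i,k) = ∑_{j≥1} ν(I_j)·μ⁽ʲ⁾(k). (Fock-diagonal version of Theorem 5.1, part 2.) -/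
open MeasureTheory Filter Real
open scoped ENNReal

/-- The local Gibbs distribution on the finite Rabi sector `{a,…,b−1}`. -/
noncomputable def sectorGibbs (β ε : ℝ) (a b : ℕ) (k : ℕ) : ℝ :=
  if k ∈ Finset.Ico a b then
    Real.exp (-(k : ℝ) * (β * ε)) / ∑ i ∈ Finset.Ico a b, Real.exp (-(i : ℝ) * (β * ε))
  else 0

lemma contr_aux {S : Type} [Fintype S] [DecidableEq S] (Q : Matrix S S ℝ)
    (h0 : ∀ i l, 0 ≤ Q i l) (h1 : ∀ i, ∑ l, Q i l = 1) (a : S) (δ : ℝ)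
    (hδ : ∀ i, δ ≤ Q i a) (v : S → ℝ) (hv : ∑ i, v i = 0) :
    ∑ l, |∑ i, v i * Q i l| ≤ (1 - δ) * ∑ i, |v i| := by
  have e : ∀ l, ∑ i, v i * Q i l = ∑ i, v i * (Q i l - if l = a then δ else 0) := by
    intro l
    simp only [mul_sub, Finset.sum_sub_distrib]
    rw [← Finset.sum_mul, hv]; simp
  have nn : ∀ i l, 0 ≤ Q i l - if l = a then δ else 0 := by
    intro i l
    split_ifs with h
    · subst h; linarith [hδ i]
    · linarith [h0 i l]
  calc ∑ l, |∑ i, v i * Q i l|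
      ≤ ∑ l, ∑ i, |v i| * (Q i l - if l = a then δ else 0) := by
        apply Finset.sum_le_sum
        intro l _
        rw [e l]
        refine (Finset.abs_sum_le_sum_abs _ _).trans (le_of_eq ?_)
        refine Finset.sum_congr rfl fun i _ => ?_
        rw [abs_mul, abs_of_nonneg (nn i l)]
    _ = (1 - δ) * ∑ i, |v i| := by
        rw [Finset.sum_comm, Finset.mul_sum]
        refine Finset.sum_congr rfl fun i _ => ?_
        rw [← Finset.mul_sum, Finset.sum_sub_distrib, h1]
        simp [mul_comm]

lemma pow_stoch {S : Type} [Fintype S] [DecidableEq S] (P : Matrix S S ℝ)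
    (h0 : ∀ i l, 0 ≤ P i l) (h1 : ∀ i, ∑ l, P i l = 1) (m : ℕ) :
    (∀ i l, 0 ≤ (P ^ m) i l) ∧ ∀ i, ∑ l, (P ^ m) i l = 1 := by
  induction m with
  | zero =>
    constructor
    · intro i l
      simp only [pow_zero, Matrix.one_apply]; split_ifs <;> norm_num
    · intro i; simp [Matrix.one_apply]
  | succ m ih =>
    constructor
    · intro i l
      rw [pow_succ, Matrix.mul_apply]
      exact Finset.sum_nonneg fun j _ => mul_nonneg (ih.1 i j) (h0 j l)
    · intro i
      simp only [pow_succ, Matrix.mul_apply]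
      rw [Finset.sum_comm]
      simp only [← Finset.mul_sum, h1, mul_one, ih.2]

lemma conv_aux {S : Type} [Fintype S] [DecidableEq S] (P : Matrix S S ℝ)
    (h0 : ∀ i l, 0 ≤ P i l) (h1 : ∀ i, ∑ l, P i l = 1) (a : S) (N : ℕ)
    (hN : ∀ i, 0 < (P ^ N) i a) (w : S → ℝ) (hw : ∑ i, w i = 1)
    (hinv : ∀ l, ∑ i, w i * P i l = w l) (i k : S) :
    Tendsto (fun t : ℕ => (P ^ t) i k) atTop (nhds (w k)) := by
  have hinvm : ∀ m l, ∑ i, w i * (P ^ m) i l = w l := by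
    intro m
    induction m with
    | zero => intro l; simp [Matrix.one_apply]
    | succ m ih =>
      intro l
      simp only [pow_succ, Matrix.mul_apply, Finset.mul_sum]
      rw [Finset.sum_comm]
      simp only [← mul_assoc, ← Finset.sum_mul, ih, hinv]
  obtain ⟨δ, hδ0, hδ⟩ : ∃ δ : ℝ, 0 < δ ∧ ∀ i, δ ≤ (P ^ N) i a := by
    have : Nonempty S := ⟨a⟩
    obtain ⟨x, hx⟩ := Finite.exists_min (fun i => (P ^ N) i a)
    exact ⟨_, hN x, hx⟩
  set v : ℕ → S → ℝ := fun t l => (P ^ t) i l - w l with hvdef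
  have hv0 : ∀ t, ∑ l, v t l = 0 := by
    intro t
    simp only [hvdef, Finset.sum_sub_distrib, (pow_stoch P h0 h1 t).2, hw, sub_self]
  have hstep : ∀ t m l, v (t + m) l = ∑ j, v t j * (P ^ m) j l := by
    intro t m l
    simp only [hvdef, sub_mul, Finset.sum_sub_distrib, hinvm, pow_add, Matrix.mul_apply]
  set f : ℕ → ℝ := fun t => ∑ l, |v t l| with hf
  have hfc : ∀ t m δ, (∀ i, δ ≤ (P ^ m) i a) → f (t + m) ≤ (1 - δ) * f t := by
    intro t m δ h
    simp only [hf, hstep t m]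
    exact contr_aux _ (pow_stoch P h0 h1 m).1 (pow_stoch P h0 h1 m).2 a δ h _ (hv0 t)
  have hf0 : ∀ t, 0 ≤ f t := fun t => Finset.sum_nonneg fun _ _ => abs_nonneg _
  have hanti : Antitone f := antitone_nat_of_succ_le fun t => by
    have := hfc t 1 0 (fun j => (pow_stoch P h0 h1 1).1 j a)
    linarith
  have hlim := tendsto_atTop_ciInf hanti ⟨0, by rintro _ ⟨t, rfl⟩; exact hf0 t⟩
  set L := ⨅ t, f t
  have hL0 : 0 ≤ L := ge_of_tendsto' hlim hf0
  have hL1 : L ≤ (1 - δ) * L :=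
    le_of_tendsto_of_tendsto' ((tendsto_add_atTop_iff_nat N).2 hlim) (hlim.const_mul _)
      (fun t => hfc t N δ hδ)
  have hL : L = 0 := by nlinarith
  rw [hL] at hlim
  have hvk : Tendsto (fun t => v t k) atTop (nhds 0) := by
    apply squeeze_zero_norm _ hlim
    intro t
    rw [Real.norm_eq_abs]
    exact Finset.single_le_sum (f := fun l => |v t l|) (fun _ _ => abs_nonneg _) (Finset.mem_univ k)
  have := hvk.add_const (w k)
  simpa [hvdef] using this

lemma pP_add (β ε : ℝ) : pMinus β ε + pPlus β ε = 1 := by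
  unfold pMinus pPlus
  have := Real.exp_pos (-(β * ε))
  field_simp

lemma pM_pos (β ε : ℝ) : 0 < pMinus β ε := by
  unfold pMinus; positivity

lemma pP_pos (β ε : ℝ) : 0 < pPlus β ε := by
  unfold pPlus; positivity

lemma alpha_zero (ξ η : ℝ) : rabiAlpha ξ η 0 = 0 := by simp [rabiAlpha]

lemma alpha_nonneg (ξ η : ℝ) (hξ : 0 < ξ) (hη : 0 ≤ η) (k : ℕ) : 0 ≤ rabiAlpha ξ η k := by
  unfold rabiAlpha; split_ifs
  · exact le_rfl
  · positivity

lemma alpha_le (ξ η : ℝ) (hξ : 0 < ξ) (hη : 0 ≤ η) (k : ℕ) : rabiAlpha ξ η k ≤ 1 := by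
  unfold rabiAlpha; split_ifs with h
  · norm_num
  · have hk : (0 : ℝ) < k := by exact_mod_cast Nat.pos_of_ne_zero h
    have h2 : 0 < ξ * k := by positivity
    rw [div_le_one (by linarith)]
    have := Real.sin_sq_le_one (Real.pi * Real.sqrt (ξ * k + η))
    nlinarith

lemma alpha_res (ξ η : ℝ) (n : ℕ) (h : IsRabiResonance ξ η n) : rabiAlpha ξ η n = 0 := by
  obtain ⟨h1, j, hj⟩ := h
  unfold rabiAlpha
  rw [if_neg (by omega), hj, Real.sqrt_sq (Nat.cast_nonneg j), mul_comm Real.pi,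
    Real.sin_nat_mul_pi]
  simp

lemma alpha_pos (ξ η : ℝ) (hξ : 0 < ξ) (hη : 0 ≤ η) (n : ℕ) (hn : 1 ≤ n)
    (h : ¬ IsRabiResonance ξ η n) : 0 < rabiAlpha ξ η n := by
  unfold rabiAlpha
  rw [if_neg (by omega)]
  have hk : (0 : ℝ) < n := by exact_mod_cast hn
  have h2 : 0 < ξ * n := by positivity
  have hs : Real.sin (Real.pi * Real.sqrt (ξ * n + η)) ≠ 0 := by
    intro hs
    rw [Real.sin_eq_zero_iff] at hs
    obtain ⟨m, hm⟩ := hs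
    have hm' : (m : ℝ) = Real.sqrt (ξ * n + η) := by
      have := Real.pi_pos
      rw [mul_comm] at hm
      exact mul_left_cancel₀ this.ne' hm
    refine h ⟨hn, m.natAbs, ?_⟩
    rw [Nat.cast_natAbs, Int.cast_abs, sq_abs, hm', Real.sq_sqrt (by linarith)]
  positivity

lemma K_eq (β ε ξ η : ℝ) (k l : ℕ) : bdKernel β ε ξ η k l =
    (if k + 1 = l then pPlus β ε * rabiAlpha ξ η (k + 1) else 0)
    + (if k - 1 = l then pMinus β ε * rabiAlpha ξ η k else 0)
    + (if k = l then 1 - pMinus β ε * rabiAlpha ξ η k - pPlus β ε * rabiAlpha ξ η (k + 1)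
        else 0) := by
  unfold bdKernel
  rcases Nat.eq_zero_or_pos k with rfl | hk
  · rw [alpha_zero]
    split_ifs <;> first | contradiction | omega | simp
  · split_ifs <;> first | omega | simp

lemma K_nonneg (β ε ξ η : ℝ) (hξ : 0 < ξ) (hη : 0 ≤ η) (k l : ℕ) :
    0 ≤ bdKernel β ε ξ η k l := by
  have a0 := alpha_nonneg ξ η hξ hη
  have a1 := alpha_le ξ η hξ hη
  have m := pM_pos β ε
  have p := pP_pos β ε
  have s := pP_add β ε
  unfold bdKernel
  split_ifs
  · exact mul_nonneg p.le (a0 _)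
  · exact mul_nonneg m.le (a0 _)
  · nlinarith [a1 k, a1 (k + 1)]
  · exact le_rfl

lemma K_balance (β ε ξ η : ℝ) (k l : ℕ) :
    Real.exp (-(k : ℝ) * (β * ε)) * bdKernel β ε ξ η k l
      = Real.exp (-(l : ℝ) * (β * ε)) * bdKernel β ε ξ η l k := by
  have key : ∀ k : ℕ, Real.exp (-(k : ℝ) * (β * ε)) * bdKernel β ε ξ η k (k + 1)
      = Real.exp (-((k + 1 : ℕ) : ℝ) * (β * ε)) * bdKernel β ε ξ η (k + 1) k := by
    intro k
    have e : Real.exp (-((k + 1 : ℕ) : ℝ) * (β * ε))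
        = Real.exp (-(k : ℝ) * (β * ε)) * Real.exp (-(β * ε)) := by
      rw [← Real.exp_add]; congr 1; push_cast; ring
    rw [e]
    simp only [bdKernel, if_true]
    rw [if_neg (by omega)]
    unfold pPlus pMinus
    ring
  by_cases h1 : l = k + 1
  · subst h1; exact key k
  by_cases h2 : k = l + 1
  · subst h2; exact (key l).symm
  by_cases h3 : k = l
  · subst h3; rfl
  unfold bdKernel
  split_ifs <;> first | omega | simp

section sector
variable (β ε ξ η : ℝ) (a b : ℕ)

lemma K_closed (ha : rabiAlpha ξ η a = 0) (hb : rabiAlpha ξ η b = 0) (j l : ℕ)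
    (hj : j ∉ Finset.Ico a b) (hl : l ∈ Finset.Ico a b) : bdKernel β ε ξ η j l = 0 := by
  rw [Finset.mem_Ico] at hj hl
  unfold bdKernel
  split_ifs with h1 h2 h3
  · have : j + 1 = a := by omega
    rw [this, ha, mul_zero]
  · have : j = b := by omega
    rw [this, hb, mul_zero]
  · omega
  · rfl

lemma K_row (ha : rabiAlpha ξ η a = 0) (hb : rabiAlpha ξ η b = 0) (k : ℕ)
    (hk : k ∈ Finset.Ico a b) : ∑ l ∈ Finset.Ico a b, bdKernel β ε ξ η k l = 1 := by
  simp only [K_eq, Finset.sum_add_distrib, Finset.sum_ite_eq, if_pos hk]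
  rw [Finset.mem_Ico] at hk
  have e1 : (if k + 1 ∈ Finset.Ico a b then pPlus β ε * rabiAlpha ξ η (k + 1) else 0)
      = pPlus β ε * rabiAlpha ξ η (k + 1) := by
    split_ifs with h
    · rfl
    · rw [Finset.mem_Ico] at h
      have : k + 1 = b := by omega
      rw [this, hb, mul_zero]
  have e2 : (if k - 1 ∈ Finset.Ico a b then pMinus β ε * rabiAlpha ξ η k else 0)
      = pMinus β ε * rabiAlpha ξ η k := by
    split_ifs with h
    · rfl
    · rw [Finset.mem_Ico] at h
      have : k = a := by omega
      rw [this, ha, mul_zero]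
  rw [e1, e2]; ring

lemma gibbs_sum (hab : a < b) : ∑ k ∈ Finset.Ico a b, sectorGibbs β ε a b k = 1 := by
  have : ∀ k ∈ Finset.Ico a b, sectorGibbs β ε a b k =
      Real.exp (-(k : ℝ) * (β * ε)) / ∑ i ∈ Finset.Ico a b, Real.exp (-(i : ℝ) * (β * ε)) :=
    fun k hk => by rw [sectorGibbs, if_pos hk]
  rw [Finset.sum_congr rfl this, ← Finset.sum_div]
  apply div_self
  exact (Finset.sum_pos (fun _ _ => Real.exp_pos _) ⟨a, by simp [hab]⟩).ne'

lemma gibbs_inv (ha : rabiAlpha ξ η a = 0) (hb : rabiAlpha ξ η b = 0) (l : ℕ) :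
    ∑ k ∈ Finset.Ico a b, sectorGibbs β ε a b k * bdKernel β ε ξ η k l
      = sectorGibbs β ε a b l := by
  have : ∀ k ∈ Finset.Ico a b, sectorGibbs β ε a b k * bdKernel β ε ξ η k l =
      Real.exp (-(l : ℝ) * (β * ε)) / (∑ i ∈ Finset.Ico a b, Real.exp (-(i : ℝ) * (β * ε)))
        * bdKernel β ε ξ η l k :=
    fun k hk => by
      rw [sectorGibbs, if_pos hk, div_mul_eq_mul_div, K_balance, div_mul_eq_mul_div]
  rw [Finset.sum_congr rfl this, ← Finset.mul_sum, sectorGibbs]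
  split_ifs with h
  · rw [K_row β ε ξ η a b ha hb l h, mul_one]
  · have h0 : ∑ k ∈ Finset.Ico a b, bdKernel β ε ξ η l k = 0 :=
      Finset.sum_eq_zero fun k hk => K_closed β ε ξ η a b ha hb l k h hk
    rw [h0, mul_zero]

lemma pow_closed (ha : rabiAlpha ξ η a = 0) (hb : rabiAlpha ξ η b = 0) (t j l : ℕ)
    (hj : j ∉ Finset.Ico a b) (hl : l ∈ Finset.Ico a b) : bdKernelPow β ε ξ η t j l = 0 := by
  induction t generalizing l with
  | zero =>
    rw [bdKernelPow, if_neg]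
    rintro rfl; exact hj hl
  | succ t ih =>
    rw [bdKernelPow]
    convert tsum_zero with m
    by_cases hm : m ∈ Finset.Ico a b
    · rw [ih m hm, zero_mul]
    · rw [K_closed β ε ξ η a b ha hb m l hm hl, mul_zero]

noncomputable def secMat : Matrix (Finset.Ico a b) (Finset.Ico a b) ℝ :=
  fun i l => bdKernel β ε ξ η i l

lemma pow_eq (ha : rabiAlpha ξ η a = 0) (hb : rabiAlpha ξ η b = 0) (t : ℕ)
    (i l : Finset.Ico a b) :
    bdKernelPow β ε ξ η t i l = (secMat β ε ξ η a b ^ t) i l := by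
  induction t generalizing l with
  | zero =>
    simp only [bdKernelPow, pow_zero, Matrix.one_apply, Subtype.ext_iff]
  | succ t ih =>
    rw [bdKernelPow, pow_succ, Matrix.mul_apply, tsum_eq_sum (s := Finset.Ico a b)]
    · rw [← Finset.sum_coe_sort]
      refine Finset.sum_congr rfl fun j _ => ?_
      rw [ih]; rfl
    · intro m hm
      rw [K_closed β ε ξ η a b ha hb m l hm l.2, mul_zero]

lemma pow_pos_aux (hξ : 0 < ξ) (hη : 0 ≤ η) (hab : a < b)
    (ha : rabiAlpha ξ η a = 0) (hb : rabiAlpha ξ η b = 0)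
    (hpos : ∀ n, a < n → n < b → 0 < rabiAlpha ξ η n) (t : ℕ) (i : Finset.Ico a b)
    (hi : (i : ℕ) - a ≤ t) :
    0 < (secMat β ε ξ η a b ^ t) i ⟨a, by simp [hab]⟩ := by
  have st := pow_stoch (secMat β ε ξ η a b) (fun i l => K_nonneg β ε ξ η hξ hη i l)
    (fun i => by
      have := K_row β ε ξ η a b ha hb i i.2
      rwa [← Finset.sum_coe_sort] at this)
  induction t generalizing i with
  | zero =>
    have h := Finset.mem_Ico.1 i.2
    have : i = ⟨a, by simp [hab]⟩ := Subtype.ext (by simp only; omega)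
    rw [this]; simp
  | succ t ih =>
    have h := Finset.mem_Ico.1 i.2
    rw [pow_succ', Matrix.mul_apply]
    have main : ∀ j : Finset.Ico a b, 0 < bdKernel β ε ξ η i j → (j : ℕ) - a ≤ t →
        0 < ∑ j, secMat β ε ξ η a b i j * (secMat β ε ξ η a b ^ t) j ⟨a, by simp [hab]⟩ := by
      intro j hj hjt
      refine Finset.sum_pos' (fun m _ => mul_nonneg (K_nonneg β ε ξ η hξ hη i m) ((st t).1 _ _))
        ⟨j, Finset.mem_univ _, mul_pos hj (ih j hjt)⟩
    by_cases hia : (i : ℕ) = a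
    · refine main i ?_ (by omega)
      simp only [bdKernel]
      rw [if_neg (by omega), if_neg (by omega), if_pos trivial, hia, ha]
      have m := pM_pos β ε
      have p := pP_pos β ε
      have s := pP_add β ε
      nlinarith [alpha_le ξ η hξ hη (a + 1)]
    · refine main ⟨i - 1, by rw [Finset.mem_Ico]; omega⟩ ?_ (by simp only; omega)
      simp only [bdKernel]
      rw [if_neg (by omega), if_pos (by omega)]
      exact mul_pos (pM_pos β ε) (hpos i (by omega) (by omega))

lemma sector_conv (hξ : 0 < ξ) (hη : 0 ≤ η) (hab : a < b)
    (ha : rabiAlpha ξ η a = 0) (hb : rabiAlpha ξ η b = 0)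
    (hpos : ∀ n, a < n → n < b → 0 < rabiAlpha ξ η n) (i k : ℕ) (hi : i ∈ Finset.Ico a b)
    (hk : k ∈ Finset.Ico a b) :
    Tendsto (fun t : ℕ => bdKernelPow β ε ξ η t i k) atTop (nhds (sectorGibbs β ε a b k)) := by
  have := conv_aux (secMat β ε ξ η a b) (fun i l => K_nonneg β ε ξ η hξ hη i l)
    (fun i => by
      have := K_row β ε ξ η a b ha hb i i.2
      rwa [← Finset.sum_coe_sort] at this) ⟨a, by simp [hab]⟩ (b - a)
    (fun i => pow_pos_aux β ε ξ η a b hξ hη hab ha hb hpos (b - a) i (by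
      have h := Finset.mem_Ico.1 i.2
      omega))
    (fun i => sectorGibbs β ε a b i)
    (by
      have := gibbs_sum β ε a b hab
      rwa [← Finset.sum_coe_sort] at this)
    (fun l => by
      have := gibbs_inv β ε ξ η a b ha hb l
      rwa [← Finset.sum_coe_sort] at this) ⟨i, hi⟩ ⟨k, hk⟩
  simp only [← pow_eq β ε ξ η a b ha hb] at this
  exact this

end sector

/-- Fock-diagonal version of Theorem 5.1, part 2: with infinitely many
Rabi resonances `n₁ < n₂ < ⋯` (listed by `seq` with `seq 0 = 0`) and the system
non-degenerate (at most one sector is a singleton), each local Gibbs distribution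
`μ⁽ʲ⁾` is an invariant probability distribution for the birth–death kernel, and
`ν p^t (k) → ∑_j ν(I_j) μ⁽ʲ⁾(k)` for every probability distribution `ν` on `ℕ`. -/
theorem statement17 (ε β ξ η : ℝ) (hε : 0 < ε) (hξ : 0 < ξ) (hη : 0 ≤ η)
    (seq : ℕ → ℕ) (hseq0 : seq 0 = 0) (hmono : StrictMono seq)
    (hres : ∀ j : ℕ, 1 ≤ j → IsRabiResonance ξ η (seq j))
    (hall : ∀ n : ℕ, IsRabiResonance ξ η n → ∃ j : ℕ, 1 ≤ j ∧ n = seq j)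
    (hnondeg : ∀ j j' : ℕ, seq (j + 1) = seq j + 1 → seq (j' + 1) = seq j' + 1 → j = j') :
    (∀ j : ℕ,
      (∑' k : ℕ, sectorGibbs β ε (seq j) (seq (j + 1)) k) = 1 ∧
      ∀ l : ℕ, (∑' k : ℕ, sectorGibbs β ε (seq j) (seq (j + 1)) k * bdKernel β ε ξ η k l)
        = sectorGibbs β ε (seq j) (seq (j + 1)) l) ∧
    (∀ ν : ℕ → ℝ, (∀ i, 0 ≤ ν i) → (∑' i : ℕ, ν i) = 1 → ∀ k : ℕ,
      Filter.Tendsto (fun t : ℕ => ∑' i : ℕ, ν i * bdKernelPow β ε ξ η t i k)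
        Filter.atTop
        (nhds (∑' j : ℕ, (∑ i ∈ Finset.Ico (seq j) (seq (j + 1)), ν i)
          * sectorGibbs β ε (seq j) (seq (j + 1)) k))) := by
  have hz : ∀ j, rabiAlpha ξ η (seq j) = 0 := by
    intro j
    rcases Nat.eq_zero_or_pos j with rfl | hj
    · rw [hseq0, alpha_zero]
    · exact alpha_res _ _ _ (hres j hj)
  have hlt : ∀ j, seq j < seq (j + 1) := fun j => hmono (Nat.lt_succ_self j)
  have hpos : ∀ j n, seq j < n → n < seq (j + 1) → 0 < rabiAlpha ξ η n := by
    intro j n h1 h2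
    refine alpha_pos ξ η hξ hη n (by omega) fun hr => ?_
    obtain ⟨m, _, rfl⟩ := hall n hr
    have := hmono.lt_iff_lt.1 h1
    have := hmono.lt_iff_lt.1 h2
    omega
  refine ⟨fun j => ⟨?_, fun l => ?_⟩, fun ν _ _ k => ?_⟩
  · rw [tsum_eq_sum (s := Finset.Ico (seq j) (seq (j + 1)))]
    · exact gibbs_sum β ε _ _ (hlt j)
    · intro k hk; rw [sectorGibbs, if_neg hk]
  · rw [tsum_eq_sum (s := Finset.Ico (seq j) (seq (j + 1)))]
    · exact gibbs_inv β ε ξ η _ _ (hz j) (hz (j + 1)) l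
    · intro k hk; rw [sectorGibbs, if_neg hk, zero_mul]
  · obtain ⟨J, hJ⟩ : ∃ J, k ∈ Finset.Ico (seq J) (seq (J + 1)) := by
      have hex : ∃ m, k < seq m := ⟨k + 1, lt_of_lt_of_le (Nat.lt_succ_self k) (hmono.id_le (k + 1))⟩
      classical
      have h1 := Nat.find_spec hex
      have h0 : Nat.find hex ≠ 0 := by
        intro h; rw [h, hseq0] at h1; omega
      obtain ⟨J, hJ⟩ := Nat.exists_eq_succ_of_ne_zero h0
      refine ⟨J, Finset.mem_Ico.2 ⟨?_, ?_⟩⟩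
      · exact not_lt.1 (Nat.find_min hex (by omega))
      · rw [hJ] at h1; exact h1
    rw [tsum_eq_single J]
    · have e : ∀ t, ∑' i : ℕ, ν i * bdKernelPow β ε ξ η t i k
          = ∑ i ∈ Finset.Ico (seq J) (seq (J + 1)), ν i * bdKernelPow β ε ξ η t i k := by
        intro t
        apply tsum_eq_sum
        intro i hi
        rw [pow_closed β ε ξ η _ _ (hz J) (hz (J + 1)) t i k hi hJ, mul_zero]
      simp only [e, Finset.sum_mul]
      refine tendsto_finsetSum _ fun i hi => ?_
      exact (sector_conv β ε ξ η _ _ hξ hη (hlt J) (hz J) (hz (J + 1)) (hpos J) i k hi hJ).const_mul _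
    · intro j hj
      rw [sectorGibbs, if_neg, mul_zero]
      intro hk
      rw [Finset.mem_Ico] at hk hJ
      have h1 := hmono.lt_iff_lt.1 (lt_of_le_of_lt hk.1 hJ.2)
      have h2 := hmono.lt_iff_lt.1 (lt_of_le_of_lt hJ.1 hk.2)
      omega
end
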